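/- Let k be a field of characteristic 2 and l/k a finite separable field extension. Then the trace form of l/k, namely the symmetric bilinear form (x,y) ↦ Tr_{l/k}(xy) on l regarded as a k-vector space, is isometric to the trivial form of rank [l:k], i.e. to the form ((x_i),(y_i)) ↦ Σ_{i=1}^{[l:k]} x_i y_i on k^{[l:k]}. -/

import Mathlib

open Module in
/-- If `B x x = f x ^ 2` for a nondegenerate form `B` and a nonzero linear form `f` on a space of
dimension at least two, some vector `e` of norm one is such that `f` does not vanish on its
orthogonal complement. -/
theorem exists_eq_one_and_exists_orthogonal_ne_zero {K V : Type*} [Field K] [AddCommGroup V]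
    [Module K V] [FiniteDimensional K V] {B : LinearMap.BilinForm K V} (hB : B.Nondegenerate)
    {f : Dual K V} (hf : f ≠ 0) (hBf : ∀ x, B x x = f x ^ 2) (hV : 1 < finrank K V) :
    ∃ e, f e = 1 ∧ ∃ z, B e z = 0 ∧ f z ≠ 0 := by
  obtain ⟨x, hx⟩ := LinearMap.surjective hf 1
  by_contra! h
  have key (e : V) (he : f e = 1) (z : V) : f z = B e z := by
    have := h e he (z - B e z • e) (by simp [hBf, he])
    simpa [he, sub_eq_zero] using this
  have hker : LinearMap.ker f ≠ ⊥ := by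
    intro hbot
    have := LinearMap.finrank_le_finrank_of_injective (LinearMap.ker_eq_bot.1 hbot)
    rw [finrank_self] at this
    omega
  obtain ⟨w, hw, hw0⟩ := Submodule.exists_mem_ne_zero_of_ne_bot hker
  refine hw0 (hB.1 w fun z ↦ ?_)
  have h₁ := key x hx z
  have h₂ := key (x + w) (by rw [map_add, hx, LinearMap.mem_ker.1 hw, add_zero]) z
  simpa [h₁] using h₂

open Module in
/-- A nondegenerate symmetric bilinear form whose diagonal is the square of a nonzero linear form
admits an orthonormal family of full cardinality. -/
theorem LinearMap.BilinForm.exists_orthonormal_of_apply_self_eq_sq {K V : Type*} [Field K]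
    [AddCommGroup V] [Module K V] [FiniteDimensional K V] {B : LinearMap.BilinForm K V}
    (hB : B.Nondegenerate) (hs : B.IsSymm) {f : Dual K V} {n : ℕ} (hn : finrank K V = n)
    (hf : n ≠ 0 → f ≠ 0) (hBf : ∀ x, B x x = f x ^ 2) :
    ∃ v : Fin n → V, ∀ i j, B (v i) (v j) = if i = j then 1 else 0 := by
  induction n generalizing V with
  | zero => exact ⟨Fin.elim0, fun i ↦ i.elim0⟩
  | succ n ih =>
    have hf := hf n.succ_ne_zero
    obtain ⟨e, he, hez⟩ : ∃ e, f e = 1 ∧ (n ≠ 0 → ∃ z, B e z = 0 ∧ f z ≠ 0) := by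
      by_cases hn0 : n = 0
      · obtain ⟨x, hx⟩ := LinearMap.surjective hf 1
        exact ⟨x, hx, fun h ↦ absurd hn0 h⟩
      · obtain ⟨e, he, h⟩ :=
          exists_eq_one_and_exists_orthogonal_ne_zero hB hf hBf (by omega)
        exact ⟨e, he, fun _ ↦ h⟩
    have hee : B e e = 1 := by rw [hBf, he, one_pow]
    have hee0 : B e e ≠ 0 := hee ▸ one_ne_zero
    set W := B.orthogonal (Submodule.span K {e}) with hWdef
    have hW (z : V) : z ∈ W ↔ B e z = 0 := by
      rw [hWdef, BilinForm.orthogonal_span_singleton_eq_toLin_ker, LinearMap.mem_ker]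
      rfl
    have hdim : finrank K W = n := by
      have := Submodule.finrank_add_eq_of_isCompl (BilinForm.isCompl_span_singleton_orthogonal hee0)
      rw [finrank_span_singleton (by rintro rfl; simp at he), hn] at this
      change 1 + finrank K W = n + 1 at this
      omega
    obtain ⟨v, hv⟩ := ih (V := W) (B := B.restrict W) (f := f.domRestrict W)
      (BilinForm.restrict_nondegenerate_orthogonal_spanSingleton B hB hs.isRefl hee0)
      ⟨fun x y ↦ hs.eq x y⟩ hdim
      (fun hn0 h ↦ by
        obtain ⟨z, hz, hfz⟩ := hez hn0
        exact hfz (LinearMap.congr_fun h ⟨z, (hW z).2 hz⟩))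
      (fun x ↦ hBf x)
    have hev (i : Fin n) : B e (v i) = 0 := (hW _).1 (v i).2
    refine ⟨Fin.cons e fun i ↦ v i, fun i j ↦ ?_⟩
    cases i using Fin.cases with
    | zero =>
      cases j using Fin.cases with
      | zero => simpa using hee
      | succ j => simpa [Fin.succ_ne_zero, eq_comm] using hev j
    | succ i =>
      cases j using Fin.cases with
      | zero => simpa [Fin.succ_ne_zero] using (hs.eq _ _).symm.trans (hev i)
      | succ j => simpa using hv i j

/-- In characteristic `p`, the trace of a finite separable extension commutes with Frobenius. -/
theorem Algebra.trace_pow_char (k l : Type*) [Field k] [Field l] [Algebra k l]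
    (p : ℕ) [Fact p.Prime] [CharP k p] [FiniteDimensional k l] [Algebra.IsSeparable k l] (x : l) :
    Algebra.trace k l (x ^ p) = Algebra.trace k l x ^ p := by
  have : CharP (AlgebraicClosure k) p := charP_of_injective_algebraMap' k p
  apply FaithfulSMul.algebraMap_injective k (AlgebraicClosure k)
  rw [map_pow (algebraMap k (AlgebraicClosure k)), trace_eq_sum_embeddings,
    trace_eq_sum_embeddings, sum_pow_char]
  simp only [map_pow]


/-- Let `k` be a field of characteristic 2 and `l/k` a finite separable field extension.
Then the trace form of `l/k`, i.e. the symmetric bilinear form `(x, y) ↦ Tr_{l/k}(x y)`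
on `l` regarded as a `k`-vector space, is isometric to the trivial form of rank
`[l : k]`, i.e. to the form `((xᵢ), (yᵢ)) ↦ ∑ i, xᵢ yᵢ` on `k^[l:k]`. -/
theorem traceForm_isometric_trivial_of_char_two
    (k l : Type*) [Field k] [Field l] [Algebra k l] [CharP k 2]
    [FiniteDimensional k l] [Algebra.IsSeparable k l] :
    ∃ e : l ≃ₗ[k] (Fin (Module.finrank k l) → k),
      ∀ x y : l, Algebra.traceForm k l x y = ∑ i, e x i * e y i := by
  obtain ⟨v, hv⟩ := LinearMap.BilinForm.exists_orthonormal_of_apply_self_eq_sq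
    (traceForm_nondegenerate k l) (Algebra.traceForm_isSymm k) rfl
    (fun _ ↦ Algebra.trace_ne_zero k l) fun x ↦ by
      have : Fact (Nat.Prime 2) := ⟨Nat.prime_two⟩
      rw [Algebra.traceForm_apply, ← sq, Algebra.trace_pow_char k l 2]
  have hli : LinearIndependent k v :=
    LinearMap.BilinForm.linearIndependent_of_iIsOrtho (B := Algebra.traceForm k l)
      (fun i j hij ↦ by simpa [hij] using hv i j) fun i ↦ by simp [hv]
  have : Nonempty (Fin (Module.finrank k l)) := ⟨⟨0, Module.finrank_pos⟩⟩
  let b := basisOfLinearIndependentOfCardEqFinrank hli (Fintype.card_fin _)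
  have hb (i j) : Algebra.traceForm k l (b i) (b j) = if i = j then 1 else 0 := by
    simpa [b] using hv i j
  refine ⟨b.equivFun, fun x y ↦ ?_⟩
  conv_lhs => rw [← b.sum_equivFun x, ← b.sum_equivFun y]
  simp only [map_sum, map_smul, LinearMap.sum_apply, LinearMap.smul_apply, hb, smul_eq_mul]
  simp [mul_comm]
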